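/- Let d ≥ 1 and let A be a continuous ℂ^{d×d}-valued function on [-1,1]. Let Φ_A : [-1,1] → ℂ^{d×d} be differentiable with Φ_A'(t) = A(t)·Φ_A(t), Φ_A(−1) = I_d, and Φ_A(t) invertible for every t, and let Ψ_A : [-1,1] → ℂ^{d×d} be differentiable with Ψ_A'(t) = −A(t)^T·Ψ_A(t) and Ψ_A(−1) = I_d. For s = 1,…,d let y_s : [-1,1] → ℂ^d be differentiable with y_s'(t) = A(t)·y_s(t) and y_s(−1) = e_s (the s-th standard basis vector), and let p_s : [-1,1] → ℂ^d be continuous with ‖y_s − p_s‖_∞ ≤ ν_s. Let Φ_N(t) be the d×d matrix with columns p_1(t),…,p_d(t) and set ξ = (Σ_{s=1}^d ν_s²)^{1/2}. Then |Φ_A(t) − Φ_N(t)| ≤ ξ for all t ∈ [-1,1]. Moreover, if Ψ_N : [-1,1] → ℂ^{d×d} is continuous with |Ψ_A(t) − Ψ_N(t)| ≤ ω for all t ∈ [-1,1], then |Φ_A(t)·Φ_A(s)^{-1}| ≤ (ξ + ‖Φ_N‖_∞)·(ω + ‖Ψ_N‖_∞) for all s, t ∈ [-1,1]. -/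

import Mathlib

open Set

/-- The operator norm of a matrix induced by the Euclidean norm on `ℂ^d`. -/
noncomputable def matNorm {d : ℕ} (M : Matrix (Fin d) (Fin d) ℂ) : ℝ :=
  ‖LinearMap.toContinuousLinearMap (Matrix.toEuclideanLin M)‖

/-- The Euclidean norm of a vector in `ℂ^d`. -/
noncomputable def evNorm {d : ℕ} (v : Fin d → ℂ) : ℝ := Real.sqrt (∑ i, ‖v i‖ ^ 2)

/-- The sup (over `[-1,1]`) of the operator norm of a matrix-valued function. -/
noncomputable def supNormMat {d : ℕ} (F : ℝ → Matrix (Fin d) (Fin d) ℂ) : ℝ :=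
  ⨆ t : Set.Icc (-1 : ℝ) 1, matNorm (F t)

lemma apb_norm_sq {d : ℕ} (M : Matrix (Fin d) (Fin d) ℂ) (x : EuclideanSpace ℂ (Fin d)) :
    ‖Matrix.toEuclideanLin M x‖ ^ 2 = ∑ i, ‖∑ j, M i j * x j‖ ^ 2 := by
  rw [EuclideanSpace.norm_sq_eq]
  rfl

lemma apb_frob {d : ℕ} (M : Matrix (Fin d) (Fin d) ℂ) :
    matNorm M ≤ Real.sqrt (∑ s, ∑ i, ‖M i s‖ ^ 2) := by
  unfold matNorm
  refine ContinuousLinearMap.opNorm_le_bound _ (Real.sqrt_nonneg _) fun x => ?_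
  refine abs_le_of_sq_le_sq' ?_ (by positivity) |>.2
  rw [mul_pow, Real.sq_sqrt (by positivity), LinearMap.coe_toContinuousLinearMap', apb_norm_sq,
    EuclideanSpace.norm_sq_eq, Finset.sum_comm, Finset.sum_mul]
  refine Finset.sum_le_sum fun i _ => ?_
  refine le_trans ?_ (Finset.sum_mul_sq_le_sq_mul_sq _ _ _)
  gcongr
  refine (norm_sum_le _ _).trans (le_of_eq ?_)
  simp

lemma apb_mul {d : ℕ} (M N : Matrix (Fin d) (Fin d) ℂ) :
    matNorm (M * N) ≤ matNorm M * matNorm N := by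
  open scoped Matrix.Norms.L2Operator in
  exact Matrix.l2_opNorm_mul M N

lemma apb_add {d : ℕ} (M N : Matrix (Fin d) (Fin d) ℂ) :
    matNorm (M + N) ≤ matNorm M + matNorm N := by
  unfold matNorm
  rw [map_add, map_add]
  exact norm_add_le _ _

lemma apb_nonneg {d : ℕ} (M : Matrix (Fin d) (Fin d) ℂ) : 0 ≤ matNorm M := norm_nonneg _

lemma apb_transpose_le {d : ℕ} (M : Matrix (Fin d) (Fin d) ℂ) :
    matNorm M.transpose ≤ matNorm M := by
  have h1 : matNorm M.conjTranspose = matNorm M := by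
    open scoped Matrix.Norms.L2Operator in
    exact Matrix.l2_opNorm_conjTranspose M
  rw [← h1]
  refine ContinuousLinearMap.opNorm_le_bound _ (apb_nonneg _) fun x => ?_
  have h := ContinuousLinearMap.le_opNorm
    (LinearMap.toContinuousLinearMap (Matrix.toEuclideanLin M.conjTranspose))
    (WithLp.toLp 2 (fun i => star (x i)))
  have e1 : ‖(WithLp.toLp 2 (fun i => star (x i)) : EuclideanSpace ℂ (Fin d))‖ = ‖x‖ := by
    simp [EuclideanSpace.norm_eq]
  rw [e1] at h
  refine le_trans (le_of_eq ?_) h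
  rw [← sq_eq_sq₀ (norm_nonneg _) (norm_nonneg _)]
  rw [LinearMap.coe_toContinuousLinearMap', LinearMap.coe_toContinuousLinearMap',
    apb_norm_sq, apb_norm_sq]
  refine Finset.sum_congr rfl fun i _ => ?_
  rw [← norm_star (∑ j, _)]
  simp [star_sum, mul_comm]

lemma apb_cont {d : ℕ} : Continuous (matNorm : Matrix (Fin d) (Fin d) ℂ → ℝ) := by
  have : Continuous ((LinearMap.toContinuousLinearMap (𝕜 := ℂ)
      (E := EuclideanSpace ℂ (Fin d)) (F' := EuclideanSpace ℂ (Fin d))).toLinearMap ∘ₗ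
      (Matrix.toEuclideanLin (𝕜 := ℂ) (m := Fin d) (n := Fin d)).toLinearMap) :=
    LinearMap.continuous_of_finiteDimensional _
  exact this.norm

lemma apb_le_sup {d : ℕ} (F : ℝ → Matrix (Fin d) (Fin d) ℂ)
    (hF : ∀ i j : Fin d, ContinuousOn (fun t => F t i j) (Icc (-1 : ℝ) 1))
    (t : ℝ) (ht : t ∈ Icc (-1 : ℝ) 1) : matNorm (F t) ≤ supNormMat F := by
  have hc : ContinuousOn (fun t => matNorm (F t)) (Icc (-1 : ℝ) 1) :=
    apb_cont.comp_continuousOn (continuousOn_pi.2 fun i => continuousOn_pi.2 fun j => hF i j)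
  have hb := isCompact_Icc.bddAbove_image hc
  refine le_ciSup (f := fun t : Icc (-1 : ℝ) 1 => matNorm (F t)) ?_ ⟨t, ht⟩
  rw [image_eq_range] at hb
  exact hb

lemma apb_const {d : ℕ} (A Y Z : ℝ → Matrix (Fin d) (Fin d) ℂ)
    (hY : ∀ t ∈ Icc (-1 : ℝ) 1, ∀ i j : Fin d,
      HasDerivWithinAt (fun t' => Y t' i j) ((A t * Y t) i j) (Icc (-1 : ℝ) 1) t)
    (hY0 : Y (-1) = 1)
    (hZ : ∀ t ∈ Icc (-1 : ℝ) 1, ∀ i j : Fin d,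
      HasDerivWithinAt (fun t' => Z t' i j) (((-(A t).transpose) * Z t) i j) (Icc (-1 : ℝ) 1) t)
    (hZ0 : Z (-1) = 1) (t : ℝ) (ht : t ∈ Icc (-1 : ℝ) 1) :
    (Z t).transpose * Y t = 1 := by
  have hd : ∀ i j : Fin d, ∀ t ∈ Icc (-1 : ℝ) 1,
      HasDerivWithinAt (fun t' => ((Z t').transpose * Y t') i j) 0 (Icc (-1 : ℝ) 1) t := by
    intro i j t ht
    have h := HasDerivWithinAt.fun_sum (u := Finset.univ)
      fun k _ => (hZ t ht k i).mul (hY t ht k j)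
    have e : (-(A t).transpose * Z t).transpose * Y t + (Z t).transpose * (A t * Y t) = 0 := by
      simp [Matrix.transpose_mul, Matrix.mul_assoc]
    have e' := congrFun (congrFun e i) j
    rw [Matrix.add_apply, Matrix.mul_apply, Matrix.mul_apply (M := (Z t).transpose),
      ← Finset.sum_add_distrib] at e'
    refine (h.congr_deriv e')
  ext i j
  have := constant_of_derivWithin_zero (f := fun t' => ((Z t').transpose * Y t') i j)
    (fun x hx => (hd i j x hx).differentiableWithinAt)
    (fun x hx => (hd i j x (Ico_subset_Icc_self hx)).derivWithin
      (uniqueDiffOn_Icc (by norm_num) x (Ico_subset_Icc_self hx))) t ht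
  simp only [hY0, hZ0] at this
  rw [this]; simp

/-- a posteriori bounds on the fundamental solution via
approximations of it and of the adjoint fundamental solution. -/
theorem apost_bound_fundamental_solution
    (d : ℕ) (hd : 1 ≤ d)
    (A : ℝ → Matrix (Fin d) (Fin d) ℂ)
    (hA : ∀ i j : Fin d, ContinuousOn (fun t => A t i j) (Icc (-1 : ℝ) 1))
    (PhiA : ℝ → Matrix (Fin d) (Fin d) ℂ)
    (hPhiA : ∀ t ∈ Icc (-1 : ℝ) 1, ∀ i j : Fin d,
      HasDerivWithinAt (fun t' => PhiA t' i j) ((A t * PhiA t) i j) (Icc (-1 : ℝ) 1) t)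
    (hPhiA0 : PhiA (-1) = 1)
    (hPhiAinv : ∀ t ∈ Icc (-1 : ℝ) 1, IsUnit (PhiA t))
    (PsiA : ℝ → Matrix (Fin d) (Fin d) ℂ)
    (hPsiA : ∀ t ∈ Icc (-1 : ℝ) 1, ∀ i j : Fin d,
      HasDerivWithinAt (fun t' => PsiA t' i j) (((-(A t).transpose) * PsiA t) i j) (Icc (-1 : ℝ) 1) t)
    (hPsiA0 : PsiA (-1) = 1)
    (y : Fin d → ℝ → Fin d → ℂ)
    (hy : ∀ s : Fin d, ∀ t ∈ Icc (-1 : ℝ) 1,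
      HasDerivWithinAt (y s) ((A t).mulVec (y s t)) (Icc (-1 : ℝ) 1) t)
    (hy0 : ∀ s : Fin d, y s (-1) = fun i => if i = s then 1 else 0)
    (p : Fin d → ℝ → Fin d → ℂ)
    (hp : ∀ s : Fin d, ∀ i : Fin d, ContinuousOn (fun t => p s t i) (Icc (-1 : ℝ) 1))
    (nu : Fin d → ℝ)
    (hnu : ∀ s : Fin d, ∀ t ∈ Icc (-1 : ℝ) 1, evNorm (y s t - p s t) ≤ nu s)
    (PhiN : ℝ → Matrix (Fin d) (Fin d) ℂ)
    (hPhiN : ∀ t : ℝ, ∀ i s : Fin d, PhiN t i s = p s t i)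
    (ξ : ℝ) (hξ : ξ = Real.sqrt (∑ s : Fin d, nu s ^ 2)) :
    (∀ t ∈ Icc (-1 : ℝ) 1, matNorm (PhiA t - PhiN t) ≤ ξ)
    ∧ ∀ PsiN : ℝ → Matrix (Fin d) (Fin d) ℂ,
        (∀ i j : Fin d, ContinuousOn (fun t => PsiN t i j) (Icc (-1 : ℝ) 1)) →
        ∀ ω : ℝ, (∀ t ∈ Icc (-1 : ℝ) 1, matNorm (PsiA t - PsiN t) ≤ ω) →
        ∀ s ∈ Icc (-1 : ℝ) 1, ∀ t ∈ Icc (-1 : ℝ) 1,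
          matNorm (PhiA t * (PhiA s)⁻¹)
            ≤ (ξ + supNormMat PhiN) * (ω + supNormMat PsiN) := by
  have hYeq : ∀ t ∈ Icc (-1 : ℝ) 1, ∀ i s, PhiA t i s = y s t i := by
    intro t ht i s
    have h1 := apb_const A PhiA PsiA hPhiA hPhiA0 hPsiA hPsiA0 t ht
    have h2 := apb_const A (fun t => Matrix.of fun i s => y s t i) PsiA
      (fun t ht i j => (hasDerivWithinAt_pi.1 (hy j t ht)) i)
      (by ext i j; simp [hy0, Matrix.one_apply]) hPsiA hPsiA0 t ht
    have h3 : PhiA t = Matrix.of fun i s => y s t i := by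
      have h1' := mul_eq_one_comm.1 h1
      calc PhiA t = PhiA t * ((PsiA t).transpose * Matrix.of fun i s => y s t i) := by
            rw [h2, mul_one]
        _ = _ := by rw [← mul_assoc, h1', one_mul]
    rw [h3]; rfl
  have hfirst : ∀ t ∈ Icc (-1 : ℝ) 1, matNorm (PhiA t - PhiN t) ≤ ξ := by
    intro t ht
    refine (apb_frob _).trans ?_
    rw [hξ]
    refine Real.sqrt_le_sqrt (Finset.sum_le_sum fun s _ => ?_)
    have h := hnu s t ht
    have h0 : 0 ≤ nu s := (Real.sqrt_nonneg _).trans h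
    unfold evNorm at h
    rw [Real.sqrt_le_left h0] at h
    simpa [hYeq t ht, hPhiN] using h
  refine ⟨hfirst, ?_⟩
  intro PsiN hPsiN ω hω s hs t ht
  have hinv : (PhiA s)⁻¹ = (PsiA s).transpose :=
    Matrix.inv_eq_left_inv (apb_const A PhiA PsiA hPhiA hPhiA0 hPsiA hPsiA0 s hs)
  rw [hinv]
  have a1 : matNorm (PhiA t) ≤ ξ + supNormMat PhiN := by
    have h := apb_add (PhiA t - PhiN t) (PhiN t)
    rw [sub_add_cancel] at h
    have h' := apb_le_sup PhiN (fun i j => by simpa only [hPhiN] using hp j i) t ht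
    linarith [hfirst t ht]
  have a2 : matNorm (PsiA s) ≤ ω + supNormMat PsiN := by
    have h := apb_add (PsiA s - PsiN s) (PsiN s)
    rw [sub_add_cancel] at h
    linarith [hω s hs, apb_le_sup PsiN hPsiN s hs]
  exact (apb_mul _ _).trans (mul_le_mul a1 ((apb_transpose_le _).trans a2) (apb_nonneg _)
    ((apb_nonneg _).trans a1))
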